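/- arXiv:2306.00484 — 5 statements merged into one kernel-verified Lean document; each statement's English description precedes it below -/
import Mathlib

section
/- Let X be a metric space with its Borel σ-algebra and let μ denote the 1-dimensional Hausdorff measure on X. Let F : X → X be a map such that μ(F(A)) = 0 whenever A ⊆ X has μ(A) = 0. Let (γ_k)_{k≥1} be subsets of X with γ_{k+1} = F(γ_k) for all k ≥ 1, let Γ̂ ⊆ X satisfy γ_k ⊆ Γ̂ for all k ≥ 1, and assume (A3): μ((F^{-1}(γ_{k+1}) ∩ Γ̂) Δ γ_k) = 0 for all k ≥ 1, where Δ denotes symmetric difference. Then for all j, k ≥ 1: if μ(γ_j ∩ γ_k) = 0 then μ(γ_{j+1} ∩ γ_{k+1}) = 0. -/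
open MeasureTheory

/-- Let `X` be a metric space with its Borel σ-algebra and `μH[1]` the
one-dimensional Hausdorff measure. Let `F : X → X` map null sets to null sets, let
`(γ k)` for `k ≥ 1` satisfy `γ (k+1) = F '' γ k` and `γ k ⊆ Γ̂`, and assume (A3):
`μH[1] ((F ⁻¹' γ (k+1) ∩ Γ̂) ∆ γ k) = 0` for all `k ≥ 1`. Then for all `j, k ≥ 1`:
if `μH[1] (γ j ∩ γ k) = 0`, then `μH[1] (γ (j+1) ∩ γ (k+1)) = 0`. -/
theorem stmt5
    {X : Type*} [MetricSpace X] [MeasurableSpace X] [BorelSpace X]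
    (F : X → X)
    (hF : ∀ A : Set X, μH[1] A = 0 → μH[1] (F '' A) = 0)
    (γ : ℕ → Set X) (Γhat : Set X)
    (hγ : ∀ k : ℕ, 1 ≤ k → γ (k + 1) = F '' γ k)
    (hΓhat : ∀ k : ℕ, 1 ≤ k → γ k ⊆ Γhat)
    (hA3 : ∀ k : ℕ, 1 ≤ k → μH[1] (symmDiff (F ⁻¹' γ (k + 1) ∩ Γhat) (γ k)) = 0) :
    ∀ j k : ℕ, 1 ≤ j → 1 ≤ k →
      μH[1] (γ j ∩ γ k) = 0 → μH[1] (γ (j + 1) ∩ γ (k + 1)) = 0 := by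
  intro j k hj hk h
  refine measure_mono_null ?_ (hF _ (measure_union_null h (hA3 k hk)))
  rintro y ⟨hyj, hyk⟩
  rw [hγ j hj] at hyj
  obtain ⟨x, hx, rfl⟩ := hyj
  refine ⟨x, ?_, rfl⟩
  by_cases hxk : x ∈ γ k
  · exact Or.inl ⟨hx, hxk⟩
  · exact Or.inr (Or.inl ⟨⟨hyk, hΓhat j hj hx⟩, hxk⟩)
end

section
/- Let X be a metric space with its Borel σ-algebra and let μ denote the 1-dimensional Hausdorff measure on X. Let F : X → X be a map such that μ(F(A)) = 0 whenever A ⊆ X has μ(A) = 0. Let (γ_k)_{k≥1} be subsets of X with γ_{k+1} = F(γ_k) for all k ≥ 1, let Γ̂ ⊆ X satisfy γ_k ⊆ Γ̂ for all k ≥ 1, and assume (A3): μ((F^{-1}(γ_{k+1}) ∩ Γ̂) Δ γ_k) = 0 for all k ≥ 1. Assume moreover (A2): there is a set Γ₁ ⊆ X with γ_1 ⊆ Γ₁ and μ(γ_k ∩ Γ₁) = 0 for all k ≥ 2. Then μ(γ_j ∩ γ_k) = 0 whenever j, k ≥ 1 and j ≠ k. -/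
open MeasureTheory

/-- Under the hypotheses of Statement 5, together with (A2):
there is a set `Γ₁` with `γ 1 ⊆ Γ₁` and `μH[1] (γ k ∩ Γ₁) = 0` for all `k ≥ 2`,
the sets `γ j` and `γ k` are essentially disjoint for all `j ≠ k`, `j, k ≥ 1`. -/
theorem stmt6
    {X : Type*} [MetricSpace X] [MeasurableSpace X] [BorelSpace X]
    (F : X → X)
    (hF : ∀ A : Set X, μH[1] A = 0 → μH[1] (F '' A) = 0)
    (γ : ℕ → Set X) (Γhat : Set X)
    (hγ : ∀ k : ℕ, 1 ≤ k → γ (k + 1) = F '' γ k)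
    (hΓhat : ∀ k : ℕ, 1 ≤ k → γ k ⊆ Γhat)
    (hA3 : ∀ k : ℕ, 1 ≤ k → μH[1] (symmDiff (F ⁻¹' γ (k + 1) ∩ Γhat) (γ k)) = 0)
    (Γ₁ : Set X) (hΓ₁ : γ 1 ⊆ Γ₁)
    (hA2 : ∀ k : ℕ, 2 ≤ k → μH[1] (γ k ∩ Γ₁) = 0) :
    ∀ j k : ℕ, 1 ≤ j → 1 ≤ k → j ≠ k → μH[1] (γ j ∩ γ k) = 0 := by
  have step : ∀ j k : ℕ, 1 ≤ j → 1 ≤ k → μH[1] (γ j ∩ γ k) = 0 →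
      μH[1] (γ (j + 1) ∩ γ (k + 1)) = 0 := by
    intro j k hj hk h
    refine measure_mono_null ?_ (hF _ (measure_union_null h (hA3 k hk)))
    rintro y ⟨hyj, hyk⟩
    rw [hγ j hj] at hyj
    obtain ⟨x, hx, rfl⟩ := hyj
    refine ⟨x, ?_, rfl⟩
    by_cases hxk : x ∈ γ k
    · exact Or.inl ⟨hx, hxk⟩
    · exact Or.inr (Or.inl ⟨⟨hyk, hΓhat j hj hx⟩, hxk⟩)
  have lt_case : ∀ j : ℕ, 1 ≤ j → ∀ k : ℕ, j < k → μH[1] (γ j ∩ γ k) = 0 := by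
    intro j hj
    induction j, hj using Nat.le_induction with
    | base =>
      intro k hk
      have hsub : γ 1 ∩ γ k ⊆ γ k ∩ Γ₁ := fun x hx => ⟨hx.2, hΓ₁ hx.1⟩
      exact measure_mono_null hsub (hA2 k hk)
    | succ j hj ih =>
      intro k hk
      obtain ⟨k, rfl⟩ : ∃ m, k = m + 1 := ⟨k - 1, by omega⟩
      exact step j k hj (by omega) (ih k (by omega))
  intro j k hj hk hjk
  rcases lt_or_gt_of_ne hjk with h | h
  · exact lt_case j hj k h
  · rw [Set.inter_comm]
    exact lt_case k hk j h
end

section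
/- Let X be a metric space with its Borel σ-algebra and let μ denote the 1-dimensional Hausdorff measure on X. Let F : X → X be a map such that μ(F(A)) = 0 whenever A ⊆ X has μ(A) = 0. Let (γ_k)_{k≥1} be μ-measurable subsets of X with γ_{k+1} = F(γ_k) for all k ≥ 1, let Γ̂ ⊆ X satisfy γ_k ⊆ Γ̂ for all k ≥ 1, and assume (A3): μ((F^{-1}(γ_{k+1}) ∩ Γ̂) Δ γ_k) = 0 for all k ≥ 1, and (A2): there is a set Γ₁ ⊆ X with γ_1 ⊆ Γ₁ and μ(γ_k ∩ Γ₁) = 0 for all k ≥ 2. Suppose in addition there exists c > 0 with μ(γ_k) ≥ c for all k ≥ 1. Then every set B ⊆ X with γ_1 ⊆ B and F(B) ⊆ B satisfies μ(B) = ∞. -/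
open MeasureTheory

/-- If `F` maps null sets to null sets, and almost every point of `S` that `F` maps into `F '' T`
lies in `T`, then images of almost disjoint sets `A ⊆ S` and `T` are almost disjoint. -/
theorem MeasureTheory.AEDisjoint.image_of_null_symmDiff {X : Type*} [MeasurableSpace X]
    {μ : Measure X} {F : X → X} (hF : ∀ A : Set X, μ A = 0 → μ (F '' A) = 0) {A S T : Set X}
    (hAS : A ⊆ S) (hT : μ (symmDiff (F ⁻¹' (F '' T) ∩ S) T) = 0) (h : AEDisjoint μ A T) :
    AEDisjoint μ (F '' A) (F '' T) := by
  refine measure_mono_null ?_ (hF _ (measure_union_null h hT))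
  rintro _ ⟨⟨x, hx, rfl⟩, hxT⟩
  refine ⟨x, ?_, rfl⟩
  by_cases hx' : x ∈ T
  · exact Or.inl ⟨hx, hx'⟩
  · exact Or.inr (Or.inl ⟨⟨hxT, hAS hx⟩, hx'⟩)

/-- Under the hypotheses of Statement 6, with the `γ k` measurable,
if additionally there exists `c > 0` with `μH[1] (γ k) ≥ c` for all `k ≥ 1`, then
every forward-invariant set `B` containing `γ 1` has infinite one-dimensional
Hausdorff measure. -/
theorem stmt7
    {X : Type*} [MetricSpace X] [MeasurableSpace X] [BorelSpace X]
    (F : X → X)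
    (hF : ∀ A : Set X, μH[1] A = 0 → μH[1] (F '' A) = 0)
    (γ : ℕ → Set X) (Γhat : Set X)
    (hmeas : ∀ k : ℕ, 1 ≤ k → MeasurableSet (γ k))
    (hγ : ∀ k : ℕ, 1 ≤ k → γ (k + 1) = F '' γ k)
    (hΓhat : ∀ k : ℕ, 1 ≤ k → γ k ⊆ Γhat)
    (hA3 : ∀ k : ℕ, 1 ≤ k → μH[1] (symmDiff (F ⁻¹' γ (k + 1) ∩ Γhat) (γ k)) = 0)
    (Γ₁ : Set X) (hΓ₁ : γ 1 ⊆ Γ₁)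
    (hA2 : ∀ k : ℕ, 2 ≤ k → μH[1] (γ k ∩ Γ₁) = 0)
    (c : ENNReal) (hc : 0 < c) (hlen : ∀ k : ℕ, 1 ≤ k → c ≤ μH[1] (γ k)) :
    ∀ B : Set X, γ 1 ⊆ B → F '' B ⊆ B → μH[1] B = ⊤ := by
  intro B hB hFB
  have hsub : ∀ k, γ (k + 1) ⊆ B := by
    intro k
    induction k with
    | zero => exact hB
    | succ k ih =>
      rw [hγ (k + 1) (by omega)]
      exact (Set.image_mono ih).trans hFB
  have hlt : ∀ j k, j < k → AEDisjoint μH[1] (γ (j + 1)) (γ (k + 1)) := by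
    intro j
    induction j with
    | zero =>
      intro k hk
      refine measure_mono_null ?_ (hA2 (k + 1) (by omega))
      exact fun x hx => ⟨hx.2, hΓ₁ hx.1⟩
    | succ j ih =>
      intro k hk
      obtain ⟨k, rfl⟩ : ∃ l, k = l + 1 := ⟨k - 1, by omega⟩
      have hT := hA3 (k + 1) (by omega)
      rw [hγ (k + 1) (by omega)] at hT
      rw [hγ (j + 1) (by omega), hγ (k + 1) (by omega)]
      exact (ih k (by omega)).image_of_null_symmDiff hF (hΓhat (j + 1) (by omega)) hT
  have hdisj : Pairwise (Function.onFun (AEDisjoint μH[1]) fun k => γ (k + 1)) := by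
    intro j k hjk
    rcases hjk.lt_or_gt with h | h
    · exact hlt j k h
    · exact (hlt k j h).symm
  rw [eq_top_iff]
  calc (⊤ : ENNReal) = ∑' _ : ℕ, c := (ENNReal.tsum_const_eq_top_of_ne_zero hc.ne').symm
    _ ≤ ∑' k, μH[1] (γ (k + 1)) := ENNReal.tsum_le_tsum fun k => hlen (k + 1) (by omega)
    _ = μH[1] (⋃ k, γ (k + 1)) :=
      (measure_iUnion₀ hdisj fun k => (hmeas (k + 1) (by omega)).nullMeasurableSet).symm
    _ ≤ μH[1] B := measure_mono (Set.iUnion_subset hsub)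
end

section
/- Let β > 1 be a real number and define F : ℝ² → ℝ² by F(x, y) = ({β x + y}, {2 y}), where {·} denotes the fractional part (so F maps [0,1)² into itself). Let S_r = {({β + t}, {2t}) : t ∈ [0,1]}. Then for every k ≥ 1 and every point a ∈ F^[k−1](S_r) (the image of S_r under the (k−1)-fold iterate of F), there exist t ∈ [0,1], integers n_0, …, n_{k−1} ∈ ℤ and m ∈ ℤ such that, as real numbers, a = (β^k + Σ_{j=0}^{k−1} β^j 2^{k−1−j} t + Σ_{j=0}^{k−1} β^j n_j, 2^k t + m). -/
/-- Let `β > 1` and `F (x, y) = (fract (β x + y), fract (2 y))` on `ℝ²`.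
Let `S_r = {(fract (β + t), fract (2 t)) : t ∈ [0,1]}`. Then for every `k ≥ 1` and every
`a ∈ F^[k-1] '' S_r` there exist `t ∈ [0,1]`, integers `n₀, …, n_{k-1}` and `m ∈ ℤ`
such that
`a = (β^k + ∑_{j<k} β^j 2^{k-1-j} t + ∑_{j<k} β^j n_j, 2^k t + m)`. -/
theorem stmt8
    (β : ℝ) (hβ : 1 < β)
    (F : ℝ × ℝ → ℝ × ℝ)
    (hF : ∀ p : ℝ × ℝ, F p = (Int.fract (β * p.1 + p.2), Int.fract (2 * p.2)))
    (Sr : Set (ℝ × ℝ))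
    (hSr : Sr = {p : ℝ × ℝ | ∃ t ∈ Set.Icc (0 : ℝ) 1,
      p = (Int.fract (β + t), Int.fract (2 * t))}) :
    ∀ k : ℕ, 1 ≤ k → ∀ a ∈ F^[k - 1] '' Sr,
      ∃ t ∈ Set.Icc (0 : ℝ) 1, ∃ n : ℕ → ℤ, ∃ m : ℤ,
        a = (β ^ k + (∑ j ∈ Finset.range k, β ^ j * 2 ^ (k - 1 - j) * t)
              + ∑ j ∈ Finset.range k, β ^ j * (n j : ℝ),
             2 ^ k * t + (m : ℝ)) := by
  intro k hk
  induction k, hk using Nat.le_induction with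
  | base =>
    rintro a ⟨p, hp, rfl⟩
    rw [hSr] at hp
    obtain ⟨t, ht, rfl⟩ := hp
    refine ⟨t, ht, fun _ => -⌊β + t⌋, -⌊2 * t⌋, ?_⟩
    simp [Int.fract, sub_eq_add_neg]
  | succ k hk ih =>
    rintro a ⟨p, hp, rfl⟩
    obtain ⟨t, ht, n, m, h⟩ := ih _ ⟨p, hp, rfl⟩
    have hstep : F^[k + 1 - 1] p = F (F^[k - 1] p) := by
      rw [← Function.iterate_succ_apply' F]
      congr 2
      omega
    rw [hstep, h, hF]
    simp only [Int.fract]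
    generalize ⌊β * _ + _⌋ = u
    generalize ⌊(2 : ℝ) * _⌋ = v
    refine ⟨t, ht, fun j => Nat.casesOn j (m - u) n, 2 * m - v, ?_⟩
    rw [Finset.sum_range_succ', Finset.sum_range_succ']
    have hexp : ∀ j, k + 1 - 1 - (j + 1) = k - 1 - j := fun j => by omega
    simp only [hexp, Prod.mk.injEq]
    constructor
    · simp only [mul_add, Finset.mul_sum, pow_succ']
      push_cast
      simp only [mul_assoc, pow_zero, Nat.sub_zero, Nat.rec_zero, Int.cast_sub]
      ring
    · push_cast
      ring
end

section
/- Let β > 1 be a transcendental real number (transcendental over ℚ) and define F : ℝ² → ℝ² by F(x, y) = ({β x + y}, {2 y}), where {·} denotes the fractional part. Let S_r = {({β + t}, {2t}) : t ∈ [0,1]} and S_l = {({t}, {2t}) : t ∈ [0,1]}. Then for every k ≥ 1 the sets F^[k−1](S_r) and F^[k−1](S_l) are disjoint: F^[k−1](S_r) ∩ F^[k−1](S_l) = ∅. -/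
open Polynomial in
/-- If the second coordinates of two points differ by a rational and the first coordinates differ
by a nonconstant rational polynomial in a transcendental `β`, the orbits of the points under the
torus map `(x, y) ↦ ({β x + y}, {2 y})` never meet. -/
theorem iterate_ne_of_sub_eq_aeval {β : ℝ} (hβt : Transcendental ℚ β) {F : ℝ × ℝ → ℝ × ℝ}
    (hF : ∀ p : ℝ × ℝ, F p = (Int.fract (β * p.1 + p.2), Int.fract (2 * p.2))) (n : ℕ) :
    ∀ p q : ℝ × ℝ, (∃ r : ℚ, p.2 - q.2 = r) →
      (∃ P : ℚ[X], 0 < P.natDegree ∧ p.1 - q.1 = aeval β P) → F^[n] p ≠ F^[n] q := by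
  induction n with
  | zero =>
    rintro p q - ⟨P, hP, h⟩ hpq
    have h0 : aeval β P = 0 := by
      rw [← h, show p = q from hpq, sub_self]
    have := transcendental_iff.1 hβt P h0
    simp [this] at hP
  | succ n ih =>
    rintro p q ⟨r, hr⟩ ⟨P, hP, h⟩
    rw [Function.iterate_succ_apply, Function.iterate_succ_apply]
    apply ih
    · refine ⟨2 * r - ⌊2 * p.2⌋ + ⌊2 * q.2⌋, ?_⟩
      simp only [hF, Int.fract]
      push_cast
      linear_combination 2 * hr
    · refine ⟨P * X + C (r - ⌊β * p.1 + p.2⌋ + ⌊β * q.1 + q.2⌋), ?_, ?_⟩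
      · rw [natDegree_add_C, natDegree_mul_X (ne_zero_of_natDegree_gt hP)]
        exact Nat.succ_pos _
      · simp only [hF, Int.fract, map_add, map_mul, aeval_X, aeval_C, eq_ratCast, ← h]
        push_cast
        linear_combination hr

/-- If the second coordinates agree after `n` steps of a skew product over the doubling map,
they initially differ by a rational. -/
theorem snd_sub_eq_ratCast_of_iterate_eq {F : ℝ × ℝ → ℝ × ℝ}
    (hF : ∀ p : ℝ × ℝ, (F p).2 = Int.fract (2 * p.2)) (n : ℕ) :
    ∀ p q : ℝ × ℝ, (F^[n] p).2 = (F^[n] q).2 → ∃ r : ℚ, p.2 - q.2 = r := by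
  induction n with
  | zero => exact fun p q h => ⟨0, by simpa [sub_eq_zero] using h⟩
  | succ n ih =>
    intro p q h
    rw [Function.iterate_succ_apply, Function.iterate_succ_apply] at h
    obtain ⟨r, hr⟩ := ih _ _ h
    simp only [hF, Int.fract] at hr
    refine ⟨(r + ⌊2 * p.2⌋ - ⌊2 * q.2⌋) / 2, ?_⟩
    push_cast
    linear_combination hr / 2

/-- Let `β > 1` be transcendental (over `ℚ`) and
`F (x, y) = (fract (β x + y), fract (2 y))` on `ℝ²`. With
`S_r = {(fract (β + t), fract (2t)) : t ∈ [0,1]}` and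
`S_l = {(fract t, fract (2t)) : t ∈ [0,1]}`, for every `k ≥ 1` the sets
`F^[k-1] '' S_r` and `F^[k-1] '' S_l` are disjoint. -/
theorem stmt10
    (β : ℝ) (hβ : 1 < β) (hβt : Transcendental ℚ β)
    (F : ℝ × ℝ → ℝ × ℝ)
    (hF : ∀ p : ℝ × ℝ, F p = (Int.fract (β * p.1 + p.2), Int.fract (2 * p.2)))
    (Sr Sl : Set (ℝ × ℝ))
    (hSr : Sr = {p : ℝ × ℝ | ∃ t ∈ Set.Icc (0 : ℝ) 1,
      p = (Int.fract (β + t), Int.fract (2 * t))})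
    (hSl : Sl = {p : ℝ × ℝ | ∃ t ∈ Set.Icc (0 : ℝ) 1,
      p = (Int.fract t, Int.fract (2 * t))}) :
    ∀ k : ℕ, 1 ≤ k → (F^[k - 1] '' Sr) ∩ (F^[k - 1] '' Sl) = ∅ := by
  intro k _
  rw [Set.eq_empty_iff_forall_notMem]
  rintro z ⟨⟨p, hp, hpz⟩, ⟨q, hq, hqz⟩⟩
  rw [hSr] at hp
  rw [hSl] at hq
  obtain ⟨t, -, hp⟩ := hp
  obtain ⟨s, -, hq⟩ := hq
  have hpq := hpz.trans hqz.symm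
  obtain ⟨r, hr⟩ := snd_sub_eq_ratCast_of_iterate_eq (fun p => by rw [hF]) _ p q
    (congrArg Prod.snd hpq)
  refine iterate_ne_of_sub_eq_aeval hβt hF _ p q ⟨r, hr⟩ ?_ hpq
  simp only [hp, hq, Int.fract] at hr ⊢
  refine ⟨Polynomial.X + Polynomial.C ((r + ⌊2 * t⌋ - ⌊2 * s⌋) / 2 - ⌊β + t⌋ + ⌊s⌋), ?_, ?_⟩
  · rw [Polynomial.natDegree_add_C, Polynomial.natDegree_X]
    exact one_pos
  · simp only [map_add, Polynomial.aeval_X, Polynomial.aeval_C, eq_ratCast]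
    push_cast
    linear_combination hr / 2
end
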